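/- Fix q > 1 and assume the standing convergence conditions (C2), (C3), (C4) hold for (b_n, c_n, ν_n) and (b, c, ν). Assume I_n(q) = ∫_{x≥1} e^{qx/(q−1)} dν_n(x) < ∞ for every n and I_n(q) → +∞. For each n let β_n ∈ ℝ satisfy F^n(β_n) = 0 and suppose that 1 + (q−1)β_n(eˣ−1) > 0 for ν_n-almost every x. Then β_n → 0 as n → ∞. -/

import Mathlib

open MeasureTheory Filter Set
open scoped ENNReal

/-- The truncation function `h(x) = x · 1_{|x| ≤ 1}`. -/
noncomputable def htrunc (x : ℝ) : ℝ := if |x| ≤ 1 then x else 0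

/-- `Y_u(x) = (1 + (q-1)u(eˣ-1))^{1/(q-1)}` if `1 + (q-1)u(eˣ-1) ≥ 0`, else `0`. -/
noncomputable def Yq (q u x : ℝ) : ℝ :=
  if 0 ≤ 1 + (q - 1) * u * (Real.exp x - 1) then
    (1 + (q - 1) * u * (Real.exp x - 1)) ^ (1 / (q - 1))
  else 0

/-- `F(u) = b + c/2 + c·u + ∫ ((eˣ-1)Y_u(x) - h(x)) dν(x)`. -/
noncomputable def Fq (q b c : ℝ) (ν : Measure ℝ) (u : ℝ) : ℝ :=
  b + c / 2 + c * u + ∫ x, ((Real.exp x - 1) * Yq q u x - htrunc x) ∂ν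

lemma Yq_nonneg (q u x : ℝ) : 0 ≤ Yq q u x := by
  unfold Yq
  split_ifs with h
  · exact Real.rpow_nonneg h _
  · exact le_rfl

lemma measurable_Yq (q u : ℝ) : Measurable (Yq q u) := by
  unfold Yq
  refine Measurable.ite ?_ (by fun_prop) measurable_const
  exact measurableSet_le measurable_const (by fun_prop)

lemma measurable_htrunc : Measurable htrunc := by
  unfold htrunc
  refine Measurable.ite ?_ measurable_id measurable_const
  exact measurableSet_le (by fun_prop) measurable_const

lemma Yq_le_rpow {q u x s : ℝ} (hq : 1 < q)
    (hs : 0 ≤ s) (h : 1 + (q - 1) * u * (Real.exp x - 1) ≤ s) :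
    Yq q u x ≤ s ^ (1 / (q - 1)) := by
  have hr : 0 ≤ 1 / (q - 1) := by
    have : 0 < q - 1 := by linarith
    positivity
  unfold Yq
  split_ifs with h0
  · exact Real.rpow_le_rpow h0 h hr
  · exact Real.rpow_nonneg hs _

lemma rpow_le_Yq {q u x s : ℝ} (hq : 1 < q)
    (hs : 0 ≤ s) (h : s ≤ 1 + (q - 1) * u * (Real.exp x - 1)) :
    s ^ (1 / (q - 1)) ≤ Yq q u x := by
  have hr : 0 ≤ 1 / (q - 1) := by
    have : 0 < q - 1 := by linarith
    positivity
  unfold Yq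
  rw [if_pos (hs.trans h)]
  exact Real.rpow_le_rpow hs h hr

lemma exp_mul_div_sub_one {q : ℝ} (hq : 1 < q) (x : ℝ) :
    Real.exp (q * x / (q - 1)) = Real.exp x * Real.exp x ^ (1 / (q - 1)) := by
  have : q - 1 ≠ 0 := by linarith
  rw [← Real.exp_mul, ← Real.exp_add]
  congr 1
  field_simp
  ring

lemma sub_one_le_exp_sub_one_mul_Yq {q u : ℝ} (hq : 1 < q) (hu : 0 ≤ u) (x : ℝ) :
    Real.exp x - 1 ≤ (Real.exp x - 1) * Yq q u x := by
  have hqu : 0 ≤ (q - 1) * u := mul_nonneg (by linarith) hu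
  rcases le_total 0 (Real.exp x - 1) with h | h
  · have := rpow_le_Yq (u := u) (x := x) hq zero_le_one (by nlinarith [mul_nonneg hqu h])
    rw [Real.one_rpow] at this
    nlinarith
  · have := Yq_le_rpow (u := u) (x := x) hq zero_le_one
      (by nlinarith [mul_nonneg hqu (neg_nonneg.2 h)])
    rw [Real.one_rpow] at this
    nlinarith

lemma isBigO_exp_sub_one_mul_Yq_sub_htrunc (q u : ℝ) :
    (fun x => (Real.exp x - 1) * Yq q u x - htrunc x) =O[nhds 0] fun x : ℝ => x ^ 2 := by
  have hd : HasDerivAt (fun x => 1 + (q - 1) * u * (Real.exp x - 1)) ((q - 1) * u * Real.exp 0)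
      0 := by
    simpa using (((Real.hasDerivAt_exp 0).sub_const 1).const_mul ((q - 1) * u)).const_add 1
  have hY := (hd.rpow_const (p := 1 / (q - 1)) (Or.inl (by simp))).isBigO_sub
  have hE := (Real.hasDerivAt_exp 0).isBigO_sub
  simp only [Real.exp_zero, sub_self, mul_zero, add_zero, Real.one_rpow, sub_zero] at hY hE
  have h2 : (fun x => Real.exp x - 1 - x) =O[nhds 0] fun x : ℝ => x ^ 2 := by
    refine Asymptotics.IsBigO.of_bound 1 ?_
    filter_upwards [Metric.closedBall_mem_nhds (0 : ℝ) one_pos] with x hx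
    rw [mem_closedBall_zero_iff, Real.norm_eq_abs] at hx
    simpa using Real.abs_exp_sub_one_sub_id_le hx
  have h3 := (hE.mul hY).add (h2.congr_right fun x => pow_two x)
  refine (h3.congr' ?_ (.of_forall fun x => (pow_two x).symm))
  have hp : ∀ᶠ x in nhds (0 : ℝ), 0 < 1 + (q - 1) * u * (Real.exp x - 1) :=
    hd.continuousAt.eventually (lt_mem_nhds (by simp))
  filter_upwards [Metric.closedBall_mem_nhds (0 : ℝ) one_pos, hp] with x hx hpx
  rw [mem_closedBall_zero_iff, Real.norm_eq_abs] at hx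
  rw [Yq, if_pos hpx.le, htrunc, if_pos hx]
  ring

lemma abs_htrunc_le_one (x : ℝ) : |htrunc x| ≤ 1 := by
  unfold htrunc
  split_ifs with h
  · exact h
  · simp

lemma exists_abs_exp_sub_one_mul_Yq_sub_htrunc_le {q u : ℝ} (hq : 1 < q) (hu : 0 ≤ u) :
    ∃ C B : ℝ, ∀ x, |(Real.exp x - 1) * Yq q u x - htrunc x| ≤
      C * min (x ^ 2) 1 +
        B * (Ici (1 : ℝ)).indicator (fun x => Real.exp (q * x / (q - 1))) x := by
  have hqu : 0 ≤ (q - 1) * u := mul_nonneg (by linarith) hu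
  obtain ⟨c, hc, hO⟩ := (isBigO_exp_sub_one_mul_Yq_sub_htrunc q u).exists_pos
  obtain ⟨δ, hδ, hball⟩ := Metric.eventually_nhds_iff.1 hO.bound
  set d := min δ 1 with hd
  have hd0 : 0 < d := lt_min hδ one_pos
  have hd1 : d ≤ 1 := min_le_right _ _
  set A := (1 + (q - 1) * u * 2) ^ (1 / (q - 1)) with hA
  have hA0 : 0 ≤ A := Real.rpow_nonneg (by linarith) _
  set B := (1 + (q - 1) * u) ^ (1 / (q - 1)) with hB
  have hB0 : 0 ≤ B := Real.rpow_nonneg (by linarith) _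
  set D := (2 * A + 1) / d ^ 2 with hD
  have hD1 : 1 ≤ D := by
    rw [hD, le_div_iff₀ (by positivity)]
    nlinarith
  refine ⟨c + D, B, fun x => ?_⟩
  have hm0 : 0 ≤ min (x ^ 2) 1 := le_min (sq_nonneg x) zero_le_one
  have hind : 0 ≤ B * (Ici (1 : ℝ)).indicator (fun x => Real.exp (q * x / (q - 1))) x :=
    mul_nonneg hB0 (indicator_nonneg (fun _ _ => (Real.exp_pos _).le) x)
  have hY0 := Yq_nonneg q u x
  have hh := abs_htrunc_le_one x
  rcases lt_or_ge |x| d with hx | hx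
  · have h1 := hball (y := x) (by
      rw [dist_zero_right, Real.norm_eq_abs]; exact hx.trans_le (min_le_left _ _))
    rw [Real.norm_eq_abs, Real.norm_eq_abs, abs_of_nonneg (sq_nonneg x)] at h1
    have h2 : min (x ^ 2) 1 = x ^ 2 := min_eq_left (by
      rw [← sq_abs]; nlinarith [abs_nonneg x])
    rw [h2] at hm0 ⊢
    nlinarith
  have hkey : |(Real.exp x - 1) * Yq q u x - htrunc x| ≤ |Real.exp x - 1| * Yq q u x + 1 := by
    calc _ ≤ |(Real.exp x - 1) * Yq q u x| + |htrunc x| := abs_sub _ _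
      _ ≤ _ := by rw [abs_mul, abs_of_nonneg hY0]; linarith
  have he := Real.exp_pos x
  rcases lt_or_ge x 1 with hx1 | hx1
  · have h3 : Real.exp x ≤ 3 := by
      have := Real.exp_le_exp.2 hx1.le
      linarith [Real.exp_one_lt_d9]
    have h4 : |Real.exp x - 1| ≤ 2 := abs_le.2 ⟨by linarith, by linarith⟩
    have h5 : Yq q u x ≤ A := Yq_le_rpow hq (by linarith) (by nlinarith)
    have h6 : d ^ 2 ≤ min (x ^ 2) 1 := le_min (by rw [← sq_abs x]; gcongr) (by nlinarith)
    have h7 : 2 * A + 1 ≤ D * min (x ^ 2) 1 := by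
      calc 2 * A + 1 = D * d ^ 2 := by rw [hD]; field_simp
        _ ≤ _ := by gcongr
    nlinarith [mul_le_mul h4 h5 hY0 (by norm_num)]
  · have h2 : min (x ^ 2) 1 = 1 := min_eq_right (by nlinarith)
    have h3 : 1 ≤ Real.exp x := Real.one_le_exp (by linarith)
    have h4 : |Real.exp x - 1| ≤ Real.exp x := abs_le.2 ⟨by linarith, by linarith⟩
    have h5 : Yq q u x ≤ B * Real.exp x ^ (1 / (q - 1)) := by
      rw [hB, ← Real.mul_rpow (by linarith) he.le]
      exact Yq_le_rpow hq (by positivity) (by nlinarith)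
    rw [indicator_of_mem (mem_Ici.2 hx1), h2, exp_mul_div_sub_one hq]
    nlinarith [mul_le_mul h4 h5 hY0 he.le]

lemma integrable_of_lintegral_ofReal_lt_top {f : ℝ → ℝ} {μ : Measure ℝ} (hf : Measurable f)
    (hf0 : ∀ x, 0 ≤ f x) (h : ∫⁻ x, ENNReal.ofReal (f x) ∂μ < ⊤) : Integrable f μ :=
  ⟨hf.aestronglyMeasurable, (hasFiniteIntegral_iff_ofReal (.of_forall hf0)).2 h⟩

lemma integrable_indicator_exp {q : ℝ} {μ : Measure ℝ}
    (hI : ∫⁻ x in Ici (1 : ℝ), ENNReal.ofReal (Real.exp (q * x / (q - 1))) ∂μ < ⊤) :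
    Integrable ((Ici (1 : ℝ)).indicator fun x => Real.exp (q * x / (q - 1))) μ :=
  (integrable_indicator_iff measurableSet_Ici).2
    (integrable_of_lintegral_ofReal_lt_top (by fun_prop) (fun _ => (Real.exp_pos _).le) hI)

lemma integrable_exp_sub_one_mul_Yq_sub_htrunc {q u : ℝ} {μ : Measure ℝ} (hq : 1 < q)
    (hu : 0 ≤ u) (hμ : ∫⁻ x, ENNReal.ofReal (min (x ^ 2) 1) ∂μ < ⊤)
    (hI : ∫⁻ x in Ici (1 : ℝ), ENNReal.ofReal (Real.exp (q * x / (q - 1))) ∂μ < ⊤) :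
    Integrable (fun x => (Real.exp x - 1) * Yq q u x - htrunc x) μ := by
  obtain ⟨C, B, h⟩ := exists_abs_exp_sub_one_mul_Yq_sub_htrunc_le hq hu
  have h1 : Integrable (fun x : ℝ => min (x ^ 2) 1) μ :=
    integrable_of_lintegral_ofReal_lt_top (by fun_prop)
      (fun x => le_min (sq_nonneg x) zero_le_one) hμ
  have hY := measurable_Yq q u
  have hh := measurable_htrunc
  refine ((h1.const_mul C).add ((integrable_indicator_exp hI).const_mul B)).mono'
    (by fun_prop) (.of_forall h)

/-- A bounded continuous function that is `o(x²)` at the origin and bounded below by `1/2` outside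
the unit interval. -/
noncomputable def tailBump (x : ℝ) : ℝ := x ^ 4 / (1 + x ^ 4)

lemma tailBump_nonneg (x : ℝ) : 0 ≤ tailBump x := by
  unfold tailBump
  positivity

lemma tailBump_le_one (x : ℝ) : tailBump x ≤ 1 := by
  unfold tailBump
  rw [div_le_one (by positivity)]
  linarith

lemma continuous_tailBump : Continuous tailBump := by
  unfold tailBump
  exact (by fun_prop : Continuous fun x : ℝ => x ^ 4).div (by fun_prop)
    fun x => by positivity

lemma one_le_two_mul_tailBump {x : ℝ} (hx : 1 ≤ |x|) : 1 ≤ 2 * tailBump x := by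
  unfold tailBump
  have h : 1 ≤ x ^ 4 := by
    have := one_le_pow₀ hx (n := 4)
    rwa [Even.pow_abs (by decide)] at this
  rw [← mul_div_assoc, one_le_div (by positivity)]
  linarith

lemma tailBump_le_min (x : ℝ) : tailBump x ≤ min (x ^ 2) 1 := by
  refine le_min ?_ (tailBump_le_one x)
  unfold tailBump
  rw [div_le_iff₀ (by positivity)]
  nlinarith [mul_nonneg (sq_nonneg x) (sq_nonneg (x ^ 2 - 1)), sq_nonneg (x ^ 3), sq_nonneg x]

lemma tendsto_tailBump_div_sq :
    Tendsto (fun x => tailBump x / x ^ 2) (nhdsWithin 0 {(0 : ℝ)}ᶜ) (nhds 0) := by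
  have h : Tendsto (fun x : ℝ => x ^ 2 / (1 + x ^ 4)) (nhds 0) (nhds 0) := by
    have : Continuous fun x : ℝ => x ^ 2 / (1 + x ^ 4) :=
      (by fun_prop : Continuous fun x : ℝ => x ^ 2).div (by fun_prop) fun x => by positivity
    simpa using this.tendsto 0
  refine (h.mono_left nhdsWithin_le_nhds).congr' ?_
  filter_upwards [self_mem_nhdsWithin] with x hx
  have : x ≠ 0 := hx
  unfold tailBump
  field_simp

lemma integrable_tailBump {μ : Measure ℝ}
    (hμ : ∫⁻ x, ENNReal.ofReal (min (x ^ 2) 1) ∂μ < ⊤) : Integrable tailBump μ := by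
  refine (integrable_of_lintegral_ofReal_lt_top (f := fun x : ℝ => min (x ^ 2) 1) (by fun_prop)
    (fun x => le_min (sq_nonneg x) zero_le_one) hμ).mono'
    continuous_tailBump.aestronglyMeasurable (.of_forall fun x => ?_)
  rw [Real.norm_of_nonneg (tailBump_nonneg x)]
  exact tailBump_le_min x

lemma mul_indicator_exp_le {q u ε : ℝ} (hq : 1 < q) (hε : 0 < ε) (hu : ε ≤ u) (x : ℝ) :
    (1 / 2 * ((q - 1) * ε / 2) ^ (1 / (q - 1))) *
        (Ici (1 : ℝ)).indicator (fun x => Real.exp (q * x / (q - 1))) x ≤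
      ((Real.exp x - 1) * Yq q u x - htrunc x) + 2 * tailBump x := by
  have hq1 : 0 < q - 1 := by linarith
  have hlow := sub_one_le_exp_sub_one_mul_Yq hq (hε.le.trans hu) x
  have ht0 := tailBump_nonneg x
  have he := Real.exp_pos x
  rcases lt_or_ge x 1 with hx | hx
  · rw [indicator_of_notMem (by simpa using hx), mul_zero, htrunc]
    split_ifs with h
    · linarith [Real.add_one_le_exp x]
    · linarith [one_le_two_mul_tailBump (not_le.1 h).le]
  · rw [indicator_of_mem (mem_Ici.2 hx), exp_mul_div_sub_one hq]
    have h1 := one_le_two_mul_tailBump (hx.trans (le_abs_self x))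
    have h2 := (le_abs_self _).trans (abs_htrunc_le_one x)
    have h3 : Real.exp x / 2 ≤ Real.exp x - 1 := by linarith [Real.add_one_le_exp x]
    have h4 : ((q - 1) * ε / 2) ^ (1 / (q - 1)) * Real.exp x ^ (1 / (q - 1)) ≤ Yq q u x := by
      rw [← Real.mul_rpow (by positivity) he.le]
      refine rpow_le_Yq hq (by positivity) ?_
      calc (q - 1) * ε / 2 * Real.exp x = (q - 1) * ε * (Real.exp x / 2) := by ring
        _ ≤ (q - 1) * u * (Real.exp x - 1) := by
          have : 0 ≤ u := hε.le.trans hu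
          gcongr
        _ ≤ _ := by linarith
    have h5 := mul_le_mul h3 h4 (by positivity) (by linarith)
    calc _ = Real.exp x / 2 *
          (((q - 1) * ε / 2) ^ (1 / (q - 1)) * Real.exp x ^ (1 / (q - 1))) := by ring
      _ ≤ (Real.exp x - 1) * Yq q u x := h5
      _ ≤ _ := by linarith

/-- If `u ≥ ε > 0`, then `F(u)` dominates a multiple of the exponential tail moment. -/
lemma mul_toReal_lintegral_exp_le_Fq {q b c u ε : ℝ} {μ : Measure ℝ} (hq : 1 < q) (hc : 0 ≤ c)
    (hε : 0 < ε) (hu : ε ≤ u) (hμ : ∫⁻ x, ENNReal.ofReal (min (x ^ 2) 1) ∂μ < ⊤)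
    (hI : ∫⁻ x in Ici (1 : ℝ), ENNReal.ofReal (Real.exp (q * x / (q - 1))) ∂μ < ⊤) :
    (1 / 2 * ((q - 1) * ε / 2) ^ (1 / (q - 1))) *
        (∫⁻ x in Ici (1 : ℝ), ENNReal.ofReal (Real.exp (q * x / (q - 1))) ∂μ).toReal ≤
      Fq q b c μ u - b + 2 * ∫ x, tailBump x ∂μ := by
  have hg := integrable_exp_sub_one_mul_Yq_sub_htrunc hq (hε.le.trans hu) hμ hI
  have ht := (integrable_tailBump hμ).const_mul 2
  have h := integral_mono ((integrable_indicator_exp hI).const_mul _) (hg.add ht)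
    (mul_indicator_exp_le hq hε hu)
  have h' : ∫ x, ((fun x => (Real.exp x - 1) * Yq q u x - htrunc x) +
      fun x => 2 * tailBump x) x ∂μ = _ := integral_add' hg ht
  rw [h', integral_const_mul, integral_const_mul,
    integral_indicator measurableSet_Ici,
    integral_eq_lintegral_of_nonneg_ae (.of_forall fun _ => (Real.exp_pos _).le)
      (by fun_prop)] at h
  have := mul_nonneg hc (hε.le.trans hu)
  unfold Fq
  linarith

/-- If `1 + (q-1)u(eˣ-1) > 0` almost everywhere with `u ≤ -ε < 0`, the measure is supported in a
half-line bounded above, which controls its exponential tail moment. -/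
lemma lintegral_exp_le_of_le_neg {q u ε K : ℝ} {μ : Measure ℝ} (hq : 1 < q) (hε : 0 < ε)
    (hu : u ≤ -ε) (hK : 1 ≤ (q - 1) * ε * (Real.exp K - 1))
    (hμ : ∫⁻ x, ENNReal.ofReal (min (x ^ 2) 1) ∂μ < ⊤)
    (hpos : ∀ᵐ x ∂μ, 0 < 1 + (q - 1) * u * (Real.exp x - 1)) :
    ∫⁻ x in Ici (1 : ℝ), ENNReal.ofReal (Real.exp (q * x / (q - 1))) ∂μ ≤
      ENNReal.ofReal (Real.exp (q * K / (q - 1)) * 2 * ∫ x, tailBump x ∂μ) := by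
  have hq1 : 0 < q - 1 := by linarith
  rw [← integral_const_mul, ofReal_integral_eq_lintegral_ofReal
    ((integrable_tailBump hμ).const_mul _)
    (.of_forall fun x => mul_nonneg (by positivity) (tailBump_nonneg x)),
    ← lintegral_indicator measurableSet_Ici]
  refine lintegral_mono_ae ?_
  filter_upwards [hpos] with x hx
  rcases lt_or_ge x 1 with h1 | h1
  · rw [indicator_of_notMem (by simpa using h1)]
    exact zero_le
  rw [indicator_of_mem (mem_Ici.2 h1)]
  have hxK : x ≤ K := by
    by_contra! hlt
    have h2 : Real.exp K - 1 ≤ Real.exp x - 1 := by linarith [Real.exp_le_exp.2 hlt.le]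
    have h3 : 0 ≤ Real.exp x - 1 := by linarith [Real.add_one_le_exp x]
    have h4 : (q - 1) * ε * (Real.exp K - 1) ≤ (q - 1) * (-u) * (Real.exp x - 1) :=
      (mul_le_mul_of_nonneg_left h2 (by positivity)).trans
        (mul_le_mul_of_nonneg_right (by nlinarith) h3)
    linarith
  refine ENNReal.ofReal_le_ofReal ?_
  have h2 : Real.exp (q * x / (q - 1)) ≤ Real.exp (q * K / (q - 1)) := by gcongr
  nlinarith [one_le_two_mul_tailBump (h1.trans (le_abs_self x)), Real.exp_pos (q * K / (q - 1))]

/-- last case of Lemma 11: under (C2), (C3), (C4) and `I_n(q) → ∞`,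
if `F^n(β_n) = 0` and `1 + (q-1)β_n(eˣ-1) > 0` `ν_n`-a.e., then `β_n → 0`. -/
theorem stmt_19 (q b c : ℝ) (hq : 1 < q) (hc : 0 ≤ c) (ν : Measure ℝ)
    (hν0 : ν {0} = 0)
    (hν : ∫⁻ x, ENNReal.ofReal (min (x ^ 2) 1) ∂ν < ⊤)
    (bn cn : ℕ → ℝ) (hcn : ∀ n, 0 ≤ cn n) (νn : ℕ → Measure ℝ)
    (hνn0 : ∀ n, νn n {0} = 0)
    (hνn : ∀ n, ∫⁻ x, ENNReal.ofReal (min (x ^ 2) 1) ∂(νn n) < ⊤)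
    (hC2 : Tendsto bn atTop (nhds b))
    (hC3 : Tendsto (fun n => cn n + ∫ x, (htrunc x) ^ 2 ∂(νn n)) atTop
      (nhds (c + ∫ x, (htrunc x) ^ 2 ∂ν)))
    (hC4 : ∀ f : ℝ → ℝ, Continuous f → (∃ Mf : ℝ, ∀ x, |f x| ≤ Mf) →
      Tendsto (fun x => f x / x ^ 2) (nhdsWithin 0 {(0 : ℝ)}ᶜ) (nhds 0) →
      Tendsto (fun n => ∫ x, f x ∂(νn n)) atTop (nhds (∫ x, f x ∂ν)))
    (hIn : ∀ n, ∫⁻ x in Set.Ici (1 : ℝ),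
      ENNReal.ofReal (Real.exp (q * x / (q - 1))) ∂(νn n) < ⊤)
    (hIdiv : Tendsto
      (fun n => ∫⁻ x in Set.Ici (1 : ℝ),
        ENNReal.ofReal (Real.exp (q * x / (q - 1))) ∂(νn n)) atTop (nhds ⊤))
    (βn : ℕ → ℝ) (hβn : ∀ n, Fq q (bn n) (cn n) (νn n) (βn n) = 0)
    (hpos : ∀ n, ∀ᵐ x ∂(νn n), 0 < 1 + (q - 1) * βn n * (Real.exp x - 1)) :
    Tendsto βn atTop (nhds 0) := by
  have hq1 : 0 < q - 1 := by linarith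
  obtain ⟨M, hM⟩ : ∃ M, ∀ᶠ n in atTop, ∫ x, tailBump x ∂(νn n) ≤ M := by
    refine ⟨∫ x, tailBump x ∂ν + 1, ?_⟩
    refine (hC4 tailBump continuous_tailBump ⟨1, fun x => ?_⟩
      tendsto_tailBump_div_sq).eventually_le_const (lt_add_one _)
    rw [abs_of_nonneg (tailBump_nonneg x)]
    exact tailBump_le_one x
  have hlarge (A : ℝ) : ∀ᶠ n in atTop, ENNReal.ofReal A <
      ∫⁻ x in Set.Ici (1 : ℝ), ENNReal.ofReal (Real.exp (q * x / (q - 1))) ∂(νn n) :=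
    hIdiv.eventually (lt_mem_nhds ENNReal.ofReal_lt_top)
  rw [tendsto_order]
  constructor
  · intro a ha
    obtain ⟨K, hK⟩ : ∃ K, 1 ≤ (q - 1) * (-a) * (Real.exp K - 1) := by
      have h0 : 0 < (q - 1) * (-a) := mul_pos hq1 (neg_pos.2 ha)
      refine ⟨1 / ((q - 1) * (-a)), ?_⟩
      calc 1 = (q - 1) * (-a) * (1 / ((q - 1) * (-a))) := by
            rw [mul_one_div_cancel h0.ne']
        _ ≤ _ := by
            gcongr
            linarith [Real.add_one_le_exp (1 / ((q - 1) * (-a)))]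
    filter_upwards [hM, hlarge (Real.exp (q * K / (q - 1)) * 2 * M)] with n hMn hn
    by_contra! hle
    have h := lintegral_exp_le_of_le_neg hq (neg_pos.2 ha) (by linarith) hK (hνn n) (hpos n)
    refine (hn.trans_le (h.trans (ENNReal.ofReal_le_ofReal ?_))).false
    gcongr
  · intro ε hε
    set C := 1 / 2 * ((q - 1) * ε / 2) ^ (1 / (q - 1)) with hC
    have hC0 : 0 < C := by positivity
    filter_upwards [hM, hC2.eventually_const_le (sub_one_lt b),
      hlarge ((2 * M - b + 1) / C)] with n hMn hbn hn
    by_contra! hle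
    have h := mul_toReal_lintegral_exp_le_Fq (b := bn n) hq (hcn n) hε hle (hνn n) (hIn n)
    rw [hβn n, ← hC] at h
    have h2 := lt_of_not_ge fun hge => hn.not_ge (ENNReal.le_ofReal_iff_toReal_le (hIn n).ne
      (ENNReal.toReal_nonneg.trans hge) |>.2 hge)
    rw [div_lt_iff₀ hC0] at h2
    linarith
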